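/- For n = 1, every solution u as in the setup satisfies ∫_ℝ ∫_ℝ (∂_x(|u(t,x)|²))² dx dt + λ ((p−1)/(p+1)) ∫_ℝ ∫_ℝ |u(t,x)|^{p+3} dx dt ≤ ‖u₀‖³_{L²(ℝ)} · sup_{t∈ℝ} ‖∂_x u(t,·)‖_{L²(ℝ)}. -/

import Mathlib

open MeasureTheory Complex

noncomputable section

/-- `u : ℝ × ℝ → ℂ` is a smooth solution of the one-dimensional NLS
`i∂ₜu + ∂ₓ²u = λ|u|^{p-1}u`, Schwartz class in `x` locally uniformly in `t`. -/
structure NLSSolution1 (p lam : ℝ) (u : ℝ → ℝ → ℂ) : Prop where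
  smooth : ContDiff ℝ (⊤ : ℕ∞) (fun q : ℝ × ℝ => u q.1 q.2)
  decay : ∀ (k N : ℕ) (T : ℝ), ∃ C : ℝ, ∀ t : ℝ, |t| ≤ T → ∀ x : ℝ,
      |x| ^ N * ‖iteratedDeriv k (u t) x‖ ≤ C
  eq : ∀ (t x : ℝ),
      Complex.I * deriv (fun s => u s x) t + deriv (deriv (u t)) x
        = (lam : ℂ) * ((‖u t x‖ ^ (p - 1) : ℝ) : ℂ) * u t x

/-! ### Decaying functions -/

/-- Decay like `1/(1+x^2)`, locally uniformly in time. -/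
def NDec (g : ℝ → ℝ → ℝ) : Prop :=
  ∀ T : ℝ, ∃ C : ℝ, 0 ≤ C ∧ ∀ t, |t| ≤ T → ∀ x, |g t x| ≤ C * (1 + x ^ 2)⁻¹

/-- Boundedness in `x`, locally uniformly in time. -/
def NBdd (g : ℝ → ℝ → ℝ) : Prop :=
  ∀ T : ℝ, ∃ C : ℝ, 0 ≤ C ∧ ∀ t, |t| ≤ T → ∀ x, |g t x| ≤ C

theorem inv_one_add_sq_le_one (x : ℝ) : (1 + x ^ 2)⁻¹ ≤ 1 := by
  apply inv_le_one_of_one_le₀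
  nlinarith [sq_nonneg x]

theorem inv_one_add_sq_nonneg (x : ℝ) : 0 ≤ (1 + x ^ 2)⁻¹ := by positivity

theorem NDec.bdd {g : ℝ → ℝ → ℝ} (h : NDec g) : NBdd g := by
  intro T
  obtain ⟨C, hC, H⟩ := h T
  refine ⟨C, hC, fun t ht x => (H t ht x).trans ?_⟩
  nlinarith [inv_one_add_sq_le_one x]

theorem NDec.add {g h : ℝ → ℝ → ℝ} (hg : NDec g) (hh : NDec h) :
    NDec (fun t x => g t x + h t x) := by
  intro T
  obtain ⟨C, hC, H⟩ := hg T
  obtain ⟨D, hD, K⟩ := hh T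
  refine ⟨C + D, by positivity, fun t ht x => (abs_add_le _ _).trans ?_⟩
  have := H t ht x
  have := K t ht x
  linarith

theorem NDec.neg {g : ℝ → ℝ → ℝ} (hg : NDec g) : NDec (fun t x => -g t x) := by
  intro T
  obtain ⟨C, hC, H⟩ := hg T
  exact ⟨C, hC, fun t ht x => by rw [abs_neg]; exact H t ht x⟩

theorem NDec.sub {g h : ℝ → ℝ → ℝ} (hg : NDec g) (hh : NDec h) :
    NDec (fun t x => g t x - h t x) := by
  simpa [sub_eq_add_neg] using hg.add hh.neg

theorem NDec.mul_bdd {g h : ℝ → ℝ → ℝ} (hg : NDec g) (hh : NBdd h) :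
    NDec (fun t x => g t x * h t x) := by
  intro T
  obtain ⟨C, hC, H⟩ := hg T
  obtain ⟨D, hD, K⟩ := hh T
  refine ⟨C * D, by positivity, fun t ht x => ?_⟩
  rw [abs_mul]
  have h1 := H t ht x
  have h2 := K t ht x
  calc |g t x| * |h t x| ≤ (C * (1 + x ^ 2)⁻¹) * D := by gcongr
    _ = _ := by ring

theorem NDec.mul {g h : ℝ → ℝ → ℝ} (hg : NDec g) (hh : NDec h) :
    NDec (fun t x => g t x * h t x) := hg.mul_bdd hh.bdd

theorem NDec.const_mul {g : ℝ → ℝ → ℝ} (c : ℝ) (hg : NDec g) :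
    NDec (fun t x => c * g t x) := by
  have : NBdd (fun _ _ : ℝ => c) := fun T => ⟨|c|, abs_nonneg c, fun _ _ _ => le_rfl⟩
  simpa [mul_comm] using hg.mul_bdd this

theorem NDec.mono {g h : ℝ → ℝ → ℝ} (hg : NDec g) (H : ∀ t x, |h t x| ≤ |g t x|) : NDec h := by
  intro T
  obtain ⟨C, hC, K⟩ := hg T
  exact ⟨C, hC, fun t ht x => (H t x).trans (K t ht x)⟩

theorem NDec.integrable {g : ℝ → ℝ → ℝ} (hg : NDec g) (t : ℝ) (hc : Continuous (g t)) :
    Integrable (g t) := by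
  obtain ⟨C, hC, K⟩ := hg |t|
  refine Integrable.mono' (integrable_inv_one_add_sq.const_mul C) hc.aestronglyMeasurable ?_
  exact Filter.Eventually.of_forall (fun x => K t le_rfl x)

theorem near_abs (t : ℝ) : ∀ᶠ s in nhds t, |s| ≤ |t| + 1 := by
  have : Metric.ball t 1 ∈ nhds t := Metric.ball_mem_nhds t one_pos
  filter_upwards [this] with s hs
  rw [Metric.mem_ball, Real.dist_eq] at hs
  have := abs_sub_abs_le_abs_sub s t
  linarith

theorem NDec.hasDerivAt_integral {g g' : ℝ → ℝ → ℝ} (hg : NDec g) (hg' : NDec g')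
    (hc : ∀ t, Continuous (g t)) (hc' : ∀ t, Continuous (g' t))
    (hd : ∀ t x, HasDerivAt (fun s => g s x) (g' t x) t) (S : Set ℝ) (t : ℝ) :
    HasDerivAt (fun s => ∫ x in S, g s x) (∫ x in S, g' t x) t := by
  obtain ⟨C, hC, K⟩ := hg' (|t| + 1)
  refine (hasDerivAt_integral_of_dominated_loc_of_deriv_le (F := g) (F' := g')
    (bound := fun x => C * (1 + x ^ 2)⁻¹) (s := {s | |s| ≤ |t| + 1}) (near_abs t) ?_ ?_ ?_ ?_ ?_ ?_).2
  · exact Filter.Eventually.of_forall (fun s => (hc s).aestronglyMeasurable)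
  · exact (hg.integrable t (hc t)).integrableOn
  · exact (hc' t).aestronglyMeasurable
  · exact Filter.Eventually.of_forall (fun x s hs => K s hs x)
  · exact (integrable_inv_one_add_sq.const_mul C).integrableOn
  · exact Filter.Eventually.of_forall (fun x s hs => hd s x)

theorem NDec.continuous_integral {g : ℝ → ℝ → ℝ} (hg : NDec g)
    (hc : ∀ t, Continuous (g t)) (hd : ∀ x, Continuous (fun t => g t x)) :
    Continuous (fun s => ∫ x, g s x) := by
  rw [continuous_iff_continuousAt]
  intro t
  obtain ⟨C, hC, K⟩ := hg (|t| + 1)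
  refine continuousAt_of_dominated (bound := fun x => C * (1 + x ^ 2)⁻¹) ?_ ?_ ?_ ?_
  · exact Filter.Eventually.of_forall (fun s => (hc s).aestronglyMeasurable)
  · filter_upwards [near_abs t] with s hs
    exact Filter.Eventually.of_forall (fun x => K s hs x)
  · exact integrable_inv_one_add_sq.const_mul C
  · exact Filter.Eventually.of_forall (fun x => (hd x).continuousAt)

/-- Decaying and jointly continuous. -/
structure Nice (g : ℝ → ℝ → ℝ) : Prop where
  dec : NDec g
  cont : Continuous (fun q : ℝ × ℝ => g q.1 q.2)

namespace Nice
variable {g h : ℝ → ℝ → ℝ}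

theorem cx (hg : Nice g) (t : ℝ) : Continuous (g t) :=
  hg.cont.comp (Continuous.prodMk_right t)

theorem ct (hg : Nice g) (x : ℝ) : Continuous (fun t => g t x) :=
  hg.cont.comp (Continuous.prodMk_left x)

theorem add (hg : Nice g) (hh : Nice h) : Nice (fun t x => g t x + h t x) :=
  ⟨hg.dec.add hh.dec, hg.cont.add hh.cont⟩
theorem sub (hg : Nice g) (hh : Nice h) : Nice (fun t x => g t x - h t x) :=
  ⟨hg.dec.sub hh.dec, hg.cont.sub hh.cont⟩
theorem mul (hg : Nice g) (hh : Nice h) : Nice (fun t x => g t x * h t x) :=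
  ⟨hg.dec.mul hh.dec, hg.cont.mul hh.cont⟩
theorem neg (hg : Nice g) : Nice (fun t x => -g t x) :=
  ⟨hg.dec.neg, hg.cont.neg⟩
theorem const_mul (c : ℝ) (hg : Nice g) : Nice (fun t x => c * g t x) :=
  ⟨hg.dec.const_mul c, continuous_const.mul hg.cont⟩
theorem sq (hg : Nice g) : Nice (fun t x => g t x ^ 2) := by
  simpa [pow_two] using hg.mul hg
theorem rpow_bdd (hg : Nice g) (h0 : ∀ t x, 0 ≤ g t x) {r : ℝ} (hr : 0 ≤ r) :
    NBdd (fun t x => g t x ^ r) := by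
  intro T
  obtain ⟨C, hC, K⟩ := hg.dec.bdd T
  refine ⟨C ^ r, by positivity, fun t ht x => ?_⟩
  have h1 := K t ht x
  rw [abs_of_nonneg (h0 t x)] at h1
  rw [abs_of_nonneg (Real.rpow_nonneg (h0 t x) _)]
  exact Real.rpow_le_rpow (h0 t x) h1 hr
theorem rpow (hg : Nice g) (h0 : ∀ t x, 0 ≤ g t x) {r : ℝ} (hr : 1 ≤ r) :
    Nice (fun t x => g t x ^ r) := by
  have hb : NBdd (fun t x => g t x ^ (r - 1)) := hg.rpow_bdd h0 (by linarith)
  refine ⟨(hg.dec.mul_bdd hb).mono (fun t x => ?_), hg.cont.rpow_const (fun _ => Or.inr (by linarith))⟩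
  apply le_of_eq
  congr 1
  rcases (h0 t x).eq_or_lt with h | h
  · rw [← h, Real.zero_rpow (by linarith)]; simp
  · rw [Real.rpow_sub_one h.ne']; field_simp
theorem integrable (hg : Nice g) (t : ℝ) : Integrable (g t) := hg.dec.integrable t (hg.cx t)
theorem continuous_integral (hg : Nice g) : Continuous (fun s => ∫ x, g s x) :=
  hg.dec.continuous_integral hg.cx hg.ct
end Nice

theorem deriv_zero_const {E : ℝ → ℝ} (h : ∀ t, HasDerivAt E 0 t) (s t : ℝ) : E s = E t :=
  is_const_of_deriv_eq_zero (fun t => (h t).differentiableAt) (fun t => (h t).deriv) s t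

/-- If the time derivative of a density is an `x`-derivative the integral is conserved. -/
theorem conserved {g g' W : ℝ → ℝ → ℝ} (hg : Nice g) (hg' : Nice g') (hW : Nice W)
    (hd : ∀ t x, HasDerivAt (fun s => g s x) (g' t x) t)
    (hx : ∀ t x, HasDerivAt (W t) (g' t x) x) (s t : ℝ) : ∫ x, g s x = ∫ x, g t x := by
  refine deriv_zero_const (E := fun s => ∫ x, g s x) (fun t => ?_) s t
  have h1 := hg.dec.hasDerivAt_integral hg'.dec hg.cx hg'.cx hd Set.univ t
  simp only [Measure.restrict_univ] at h1
  rwa [integral_eq_zero_of_hasDerivAt_of_integrable (hx t) (hg'.integrable t) (hW.integrable t)] at h1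

/-- Pointwise bound by the integral of a majorant of the derivative. -/
theorem pointwise_le {g g' k : ℝ → ℝ} (hd : ∀ x, HasDerivAt g (g' x) x) (hg : Integrable g)
    (hg' : Integrable g') (hk : Integrable k) (hle : ∀ x, g' x ≤ k x) (hk0 : ∀ x, 0 ≤ k x) (x : ℝ) :
    g x ≤ ∫ y, k y := by
  have h0 : Filter.Tendsto g Filter.atBot (nhds 0) :=
    tendsto_zero_of_hasDerivAt_of_integrableOn_Iic (a := 0) (fun x _ => hd x) hg'.integrableOn
      hg.integrableOn
  have := integral_Iic_of_hasDerivAt_of_tendsto' (a := x) (fun y _ => hd y) hg'.integrableOn h0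
  rw [sub_zero] at this
  rw [← this]
  calc ∫ y in Set.Iic x, g' y ≤ ∫ y in Set.Iic x, k y :=
        integral_mono hg'.integrableOn hk.integrableOn hle
    _ ≤ _ := setIntegral_le_integral hk (Filter.Eventually.of_forall hk0)

/-! ### The equation in real coordinates -/

/-- A solution in real coordinates: `u = a + i b`, with `x`-derivatives `a1, a2, a3`, and
`f + i g` the nonlinearity. -/
structure Good (p lam : ℝ) (a b a1 b1 a2 b2 a3 b3 f g f1 g1 : ℝ → ℝ → ℝ) : Prop where
  hp : 1 < p
  na : Nice a
  nb : Nice b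
  na1 : Nice a1
  nb1 : Nice b1
  na2 : Nice a2
  nb2 : Nice b2
  na3 : Nice a3
  nb3 : Nice b3
  cf : Continuous (fun q : ℝ × ℝ => f q.1 q.2)
  cg : Continuous (fun q : ℝ × ℝ => g q.1 q.2)
  cf1 : Continuous (fun q : ℝ × ℝ => f1 q.1 q.2)
  cg1 : Continuous (fun q : ℝ × ℝ => g1 q.1 q.2)
  dxa : ∀ t x, HasDerivAt (fun y => a t y) (a1 t x) x
  dxb : ∀ t x, HasDerivAt (fun y => b t y) (b1 t x) x
  dxa1 : ∀ t x, HasDerivAt (fun y => a1 t y) (a2 t x) x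
  dxb1 : ∀ t x, HasDerivAt (fun y => b1 t y) (b2 t x) x
  dxa2 : ∀ t x, HasDerivAt (fun y => a2 t y) (a3 t x) x
  dxb2 : ∀ t x, HasDerivAt (fun y => b2 t y) (b3 t x) x
  dxf : ∀ t x, HasDerivAt (fun y => f t y) (f1 t x) x
  dxg : ∀ t x, HasDerivAt (fun y => g t y) (g1 t x) x
  dta : ∀ t x, HasDerivAt (fun s => a s x) (-b2 t x + g t x) t
  dtb : ∀ t x, HasDerivAt (fun s => b s x) (a2 t x - f t x) t
  dta1 : ∀ t x, HasDerivAt (fun s => a1 s x) (-b3 t x + g1 t x) t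
  dtb1 : ∀ t x, HasDerivAt (fun s => b1 s x) (a3 t x - f1 t x) t
  hf : ∀ t x, f t x = lam * (a t x ^ 2 + b t x ^ 2) ^ ((p - 1) / 2) * a t x
  hg : ∀ t x, g t x = lam * (a t x ^ 2 + b t x ^ 2) ^ ((p - 1) / 2) * b t x

/-- Derivative of `c * a` at a zero of `a`, with `c` merely continuous. -/
theorem hasDerivAt_mul_of_zero {c a : ℝ → ℝ} {a' x : ℝ} (hc : ContinuousAt c x)
    (ha : HasDerivAt a a' x) (h0 : a x = 0) : HasDerivAt (fun y => c y * a y) (c x * a') x := by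
  rw [hasDerivAt_iff_tendsto_slope] at ha ⊢
  have h1 := (hc.tendsto.mono_left (nhdsWithin_le_nhds (s := {x}ᶜ))).mul ha
  refine h1.congr (fun y => ?_)
  simp only [slope_def_field, h0]
  ring

/-- Bound for the derivative of `|u|^{p-1} a`. -/
theorem nonlin_deriv_bound {p lam : ℝ} (hp : 1 < p) {a b h : ℝ → ℝ} {a' b' h' h'' x : ℝ}
    (ha : HasDerivAt a a' x) (hb : HasDerivAt b b' x) (hh : HasDerivAt h h' x)
    (hha : h = a ∨ h = b)
    (hF : HasDerivAt (fun y => lam * (a y ^ 2 + b y ^ 2) ^ ((p - 1) / 2) * h y) h'' x) :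
    |h''| ≤ |lam| * p * (a x ^ 2 + b x ^ 2) ^ ((p - 1) / 2) * (|a'| + |b'|) := by
  set w := (a x ^ 2 + b x ^ 2) ^ ((p - 1) / 2) with hw
  have hw0 : 0 ≤ w := by positivity
  have hh' : |h'| ≤ |a'| + |b'| := by
    rcases hha with rfl | rfl
    · rw [hh.unique ha]; linarith [abs_nonneg b']
    · rw [hh.unique hb]; linarith [abs_nonneg a']
  have hhx : h x ^ 2 ≤ a x ^ 2 + b x ^ 2 := by
    rcases hha with rfl | rfl
    · nlinarith [sq_nonneg (b x)]
    · nlinarith [sq_nonneg (a x)]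
  rcases eq_or_ne (a x ^ 2 + b x ^ 2) 0 with h0 | h0
  · have hx0 : h x = 0 := by
      have : h x ^ 2 = 0 := le_antisymm (by linarith) (sq_nonneg _)
      simpa using this
    have hc : ContinuousAt (fun y => lam * (a y ^ 2 + b y ^ 2) ^ ((p - 1) / 2)) x := by
      refine ContinuousAt.mul continuousAt_const (ContinuousAt.rpow_const ?_ (Or.inr (by linarith)))
      exact (ha.continuousAt.pow 2).add (hb.continuousAt.pow 2)
    have h2 := hF.unique (hasDerivAt_mul_of_zero hc hh hx0)
    have : w = 0 := by rw [hw, h0, Real.zero_rpow (by linarith)]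
    rw [h2]
    simp only [← hw, this]
    simp
  · have hr : HasDerivAt (fun y => a y ^ 2 + b y ^ 2) (2 * (a x * a' + b x * b')) x :=
      ((ha.fun_pow 2).fun_add (hb.fun_pow 2)).congr_deriv (by push_cast; ring)
    have h1 := ((hr.rpow_const (p := (p - 1) / 2) (Or.inl h0)).const_mul lam).fun_mul hh
    have h2 := hF.unique h1
    have hpos : 0 < a x ^ 2 + b x ^ 2 := lt_of_le_of_ne (by positivity) (Ne.symm h0)
    rw [Real.rpow_sub_one h0, ← hw] at h2
    have h3 : h'' = lam * w * ((p - 1) * ((a x * a' + b x * b') * h x / (a x ^ 2 + b x ^ 2)) + h') := by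
      rw [h2]; field_simp
    have ax : |a x * h x| ≤ a x ^ 2 + b x ^ 2 := by
      rw [abs_le]; constructor <;> rcases hha with e | e <;> rw [e] <;>
        nlinarith [sq_nonneg (a x - b x), sq_nonneg (a x + b x), sq_nonneg (a x), sq_nonneg (b x)]
    have bx : |b x * h x| ≤ a x ^ 2 + b x ^ 2 := by
      rw [abs_le]; constructor <;> rcases hha with e | e <;> rw [e] <;>
        nlinarith [sq_nonneg (a x - b x), sq_nonneg (a x + b x), sq_nonneg (a x), sq_nonneg (b x)]
    have h4 : |(a x * a' + b x * b') * h x / (a x ^ 2 + b x ^ 2)| ≤ |a'| + |b'| := by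
      rw [abs_div, abs_of_pos hpos, div_le_iff₀ hpos]
      calc |(a x * a' + b x * b') * h x| = |(a x * h x) * a' + (b x * h x) * b'| := by ring_nf
        _ ≤ |(a x * h x)| * |a'| + |b x * h x| * |b'| := by
            rw [← abs_mul, ← abs_mul]; exact abs_add_le _ _
        _ ≤ (a x ^ 2 + b x ^ 2) * |a'| + (a x ^ 2 + b x ^ 2) * |b'| := by gcongr
        _ = _ := by ring
    rw [h3, abs_mul, abs_mul, abs_of_nonneg hw0]
    have h5 : |(p - 1) * ((a x * a' + b x * b') * h x / (a x ^ 2 + b x ^ 2)) + h'|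
        ≤ (p - 1) * (|a'| + |b'|) + (|a'| + |b'|) := by
      refine (abs_add_le _ _).trans (add_le_add ?_ hh')
      rw [abs_mul, abs_of_pos (by linarith : 0 < p - 1)]
      exact mul_le_mul_of_nonneg_left h4 (by linarith)
    calc |lam| * w * _ ≤ |lam| * w * ((p - 1) * (|a'| + |b'|) + (|a'| + |b'|)) := by gcongr
      _ = _ := by ring

namespace Good
variable {p lam : ℝ} {a b a1 b1 a2 b2 a3 b3 f g f1 g1 : ℝ → ℝ → ℝ}

theorem rho_nonneg (a b : ℝ → ℝ → ℝ) (t x : ℝ) : 0 ≤ a t x ^ 2 + b t x ^ 2 := by positivity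

theorem nrho (h : Good p lam a b a1 b1 a2 b2 a3 b3 f g f1 g1) :
    Nice (fun t x => a t x ^ 2 + b t x ^ 2) := h.na.sq.add h.nb.sq

theorem nf (h : Good p lam a b a1 b1 a2 b2 a3 b3 f g f1 g1) : Nice f := by
  refine ⟨?_, h.cf⟩
  refine ((h.na.dec.mul_bdd (h.nrho.rpow_bdd (rho_nonneg a b)
    (by linarith [h.hp] : 0 ≤ (p - 1) / 2))).const_mul lam).mono (fun t x => le_of_eq ?_)
  rw [h.hf]; congr 1; ring

theorem ng (h : Good p lam a b a1 b1 a2 b2 a3 b3 f g f1 g1) : Nice g := by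
  refine ⟨?_, h.cg⟩
  refine ((h.nb.dec.mul_bdd (h.nrho.rpow_bdd (rho_nonneg a b)
    (by linarith [h.hp] : 0 ≤ (p - 1) / 2))).const_mul lam).mono (fun t x => le_of_eq ?_)
  rw [h.hg]; congr 1; ring

theorem f1_le (h : Good p lam a b a1 b1 a2 b2 a3 b3 f g f1 g1) (t x : ℝ) :
    |f1 t x| ≤ |lam| * p * (a t x ^ 2 + b t x ^ 2) ^ ((p - 1) / 2) * (|a1 t x| + |b1 t x|) := by
  refine nonlin_deriv_bound h.hp (h.dxa t x) (h.dxb t x) (h.dxa t x) (Or.inl rfl) ?_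
  have := h.dxf t x
  simpa only [h.hf] using this

theorem g1_le (h : Good p lam a b a1 b1 a2 b2 a3 b3 f g f1 g1) (t x : ℝ) :
    |g1 t x| ≤ |lam| * p * (a t x ^ 2 + b t x ^ 2) ^ ((p - 1) / 2) * (|a1 t x| + |b1 t x|) := by
  refine nonlin_deriv_bound h.hp (h.dxa t x) (h.dxb t x) (h.dxb t x) (Or.inr rfl) ?_
  have := h.dxg t x
  simpa only [h.hg] using this

theorem ndaux (h : Good p lam a b a1 b1 a2 b2 a3 b3 f g f1 g1) :
    NDec (fun t x => (|lam| * p) * ((|a1 t x| + |b1 t x|) *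
      (a t x ^ 2 + b t x ^ 2) ^ ((p - 1) / 2))) := by
  have h1 : NDec (fun t x => |a1 t x|) := h.na1.dec.mono (fun t x => by simp)
  have h2 : NDec (fun t x => |b1 t x|) := h.nb1.dec.mono (fun t x => by simp)
  exact ((h1.add h2).mul_bdd (h.nrho.rpow_bdd (rho_nonneg a b)
    (by linarith [h.hp] : 0 ≤ (p - 1) / 2))).const_mul _

theorem nf1 (h : Good p lam a b a1 b1 a2 b2 a3 b3 f g f1 g1) : Nice f1 :=
  ⟨h.ndaux.mono (fun t x => ((h.f1_le t x).trans (le_of_eq (by ring))).trans (le_abs_self _)), h.cf1⟩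

theorem ng1 (h : Good p lam a b a1 b1 a2 b2 a3 b3 f g f1 g1) : Nice g1 :=
  ⟨h.ndaux.mono (fun t x => ((h.g1_le t x).trans (le_of_eq (by ring))).trans (le_abs_self _)), h.cg1⟩

theorem dxrho (h : Good p lam a b a1 b1 a2 b2 a3 b3 f g f1 g1) (t x : ℝ) :
    HasDerivAt (fun y => a t y ^ 2 + b t y ^ 2) (2 * (a t x * a1 t x + b t x * b1 t x)) x :=
  (((h.dxa t x).fun_pow 2).fun_add ((h.dxb t x).fun_pow 2)).congr_deriv (by push_cast; ring)

theorem dtrho (h : Good p lam a b a1 b1 a2 b2 a3 b3 f g f1 g1) (t x : ℝ) :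
    HasDerivAt (fun s => a s x ^ 2 + b s x ^ 2) (2 * (b t x * a2 t x - a t x * b2 t x)) t :=
  (((h.dta t x).fun_pow 2).fun_add ((h.dtb t x).fun_pow 2)).congr_deriv (by
    rw [h.hf, h.hg]; push_cast; ring)

/-- the potential energy density -/
theorem nQ (h : Good p lam a b a1 b1 a2 b2 a3 b3 f g f1 g1) :
    Nice (fun t x => (a t x ^ 2 + b t x ^ 2) ^ ((p + 1) / 2)) :=
  h.nrho.rpow (rho_nonneg a b) (by linarith [h.hp])

theorem dxQ (h : Good p lam a b a1 b1 a2 b2 a3 b3 f g f1 g1) (t x : ℝ) :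
    HasDerivAt (fun y => (a t y ^ 2 + b t y ^ 2) ^ ((p + 1) / 2))
      ((p + 1) * (a t x ^ 2 + b t x ^ 2) ^ ((p - 1) / 2) * (a t x * a1 t x + b t x * b1 t x)) x := by
  refine ((h.dxrho t x).rpow_const (p := (p + 1) / 2) (Or.inr (by linarith [h.hp]))).congr_deriv ?_
  rw [show (p + 1) / 2 - 1 = (p - 1) / 2 by ring]; ring

theorem dtQ (h : Good p lam a b a1 b1 a2 b2 a3 b3 f g f1 g1) (t x : ℝ) :
    HasDerivAt (fun s => (a s x ^ 2 + b s x ^ 2) ^ ((p + 1) / 2))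
      ((p + 1) * (a t x ^ 2 + b t x ^ 2) ^ ((p - 1) / 2) * (b t x * a2 t x - a t x * b2 t x)) t := by
  refine ((h.dtrho t x).rpow_const (p := (p + 1) / 2) (Or.inr (by linarith [h.hp]))).congr_deriv ?_
  rw [show (p + 1) / 2 - 1 = (p - 1) / 2 by ring]; ring

theorem rpow_split (h : Good p lam a b a1 b1 a2 b2 a3 b3 f g f1 g1) (t x : ℝ) :
    (a t x ^ 2 + b t x ^ 2) ^ ((p + 1) / 2) =
      (a t x ^ 2 + b t x ^ 2) ^ ((p - 1) / 2) * (a t x ^ 2 + b t x ^ 2) := by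
  rw [show (p + 1) / 2 = (p - 1) / 2 + 1 by ring,
    Real.rpow_add_of_nonneg (by positivity) (by linarith [h.hp]) (by norm_num), Real.rpow_one]

theorem nonlin (h : Good p lam a b a1 b1 a2 b2 a3 b3 f g f1 g1) (t x : ℝ) :
    a1 t x * f t x + a t x * f1 t x + (b1 t x * g t x + b t x * g1 t x) =
    lam * ((p + 1) * (a t x ^ 2 + b t x ^ 2) ^ ((p - 1) / 2) * (a t x * a1 t x + b t x * b1 t x)) := by
  have h1 := ((h.dxa t x).fun_mul (h.dxf t x)).fun_add ((h.dxb t x).fun_mul (h.dxg t x))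
  have h2 := (h.dxQ t x).const_mul lam
  refine h1.unique (h2.congr_of_eventuallyEq (Filter.Eventually.of_forall fun y => ?_))
  simp only [h.hf, h.hg, h.rpow_split]; ring

/-- mass conservation -/
theorem mass (h : Good p lam a b a1 b1 a2 b2 a3 b3 f g f1 g1) (s t : ℝ) :
    ∫ x, (a s x ^ 2 + b s x ^ 2) = ∫ x, (a t x ^ 2 + b t x ^ 2) := by
  refine conserved (W := fun t x => 2 * (b t x * a1 t x - a t x * b1 t x)) h.nrho
    (((h.nb.mul h.na2).sub (h.na.mul h.nb2)).const_mul 2)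
    (((h.nb.mul h.na1).sub (h.na.mul h.nb1)).const_mul 2) h.dtrho (fun t x => ?_) s t
  exact ((((h.dxb t x).fun_mul (h.dxa1 t x)).fun_sub ((h.dxa t x).fun_mul (h.dxb1 t x))).const_mul
    2).congr_deriv (by ring)

theorem dtkin (h : Good p lam a b a1 b1 a2 b2 a3 b3 f g f1 g1) (t x : ℝ) :
    HasDerivAt (fun s => a1 s x ^ 2 + b1 s x ^ 2)
      (2 * (a1 t x * (-b3 t x + g1 t x) + b1 t x * (a3 t x - f1 t x))) t :=
  (((h.dta1 t x).fun_pow 2).fun_add ((h.dtb1 t x).fun_pow 2)).congr_deriv (by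
    push_cast; ring)

/-- energy conservation -/
theorem energy (h : Good p lam a b a1 b1 a2 b2 a3 b3 f g f1 g1) (s t : ℝ) :
    (∫ x, (a1 s x ^ 2 + b1 s x ^ 2)) + 2 * lam / (p + 1) * ∫ x, (a s x ^ 2 + b s x ^ 2) ^ ((p + 1) / 2)
    = (∫ x, (a1 t x ^ 2 + b1 t x ^ 2)) +
      2 * lam / (p + 1) * ∫ x, (a t x ^ 2 + b t x ^ 2) ^ ((p + 1) / 2) := by
  have nk : Nice (fun t x => a1 t x ^ 2 + b1 t x ^ 2) := h.na1.sq.add h.nb1.sq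
  have key := conserved
    (g := fun t x => (a1 t x ^ 2 + b1 t x ^ 2) +
      2 * lam / (p + 1) * (a t x ^ 2 + b t x ^ 2) ^ ((p + 1) / 2))
    (g' := fun t x => 2 * (b1 t x * a3 t x - a1 t x * b3 t x + (a2 t x * g t x + a1 t x * g1 t x)
      - (b2 t x * f t x + b1 t x * f1 t x)))
    (W := fun t x => 2 * (b1 t x * a2 t x - a1 t x * b2 t x + a1 t x * g t x - b1 t x * f t x))
    (nk.add (h.nQ.const_mul _))
    (((((h.nb1.mul h.na3).sub (h.na1.mul h.nb3)).add ((h.na2.mul h.ng).add (h.na1.mul h.ng1))).sub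
      ((h.nb2.mul h.nf).add (h.nb1.mul h.nf1))).const_mul 2)
    (((((h.nb1.mul h.na2).sub (h.na1.mul h.nb2)).add (h.na1.mul h.ng)).sub
      (h.nb1.mul h.nf)).const_mul 2)
    (fun t x => ((h.dtkin t x).fun_add ((h.dtQ t x).const_mul _)).congr_deriv (by
      have := h.hp
      have : p + 1 ≠ 0 := by linarith
      rw [h.hf, h.hg]; field_simp; ring))
    (fun t x => ((((((h.dxb1 t x).fun_mul (h.dxa2 t x)).fun_sub
      ((h.dxa1 t x).fun_mul (h.dxb2 t x))).fun_add ((h.dxa1 t x).fun_mul (h.dxg t x))).fun_sub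
      ((h.dxb1 t x).fun_mul (h.dxf t x))).const_mul 2).congr_deriv (by ring)) s t
  rw [integral_add (nk.integrable s) ((h.nQ.const_mul _).integrable s),
    integral_add (nk.integrable t) ((h.nQ.const_mul _).integrable t),
    integral_const_mul, integral_const_mul] at key
  exact key

/-- derivative of the kinetic energy -/
theorem kin_deriv (h : Good p lam a b a1 b1 a2 b2 a3 b3 f g f1 g1) (t : ℝ) :
    HasDerivAt (fun s => ∫ x, (a1 s x ^ 2 + b1 s x ^ 2))
      (∫ x, 2 * (a1 t x * g1 t x - b1 t x * f1 t x)) t := by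
  have nk : Nice (fun t x => a1 t x ^ 2 + b1 t x ^ 2) := h.na1.sq.add h.nb1.sq
  have n1 : Nice (fun t x => 2 * (a1 t x * (-b3 t x + g1 t x) + b1 t x * (a3 t x - f1 t x))) :=
    ((h.na1.mul (h.nb3.neg.add h.ng1)).add (h.nb1.mul (h.na3.sub h.nf1))).const_mul 2
  have h1 := nk.dec.hasDerivAt_integral n1.dec nk.cx n1.cx h.dtkin Set.univ t
  simp only [Measure.restrict_univ] at h1
  refine h1.congr_deriv ?_
  have n2 : Nice (fun t x => 2 * (b1 t x * a3 t x - a1 t x * b3 t x)) :=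
    ((h.nb1.mul h.na3).sub (h.na1.mul h.nb3)).const_mul 2
  have n3 : Nice (fun t x => 2 * (a1 t x * g1 t x - b1 t x * f1 t x)) :=
    ((h.na1.mul h.ng1).sub (h.nb1.mul h.nf1)).const_mul 2
  have n4 : Nice (fun t x => 2 * (b1 t x * a2 t x - a1 t x * b2 t x)) :=
    ((h.nb1.mul h.na2).sub (h.na1.mul h.nb2)).const_mul 2
  have h2 : ∫ x, 2 * (b1 t x * a3 t x - a1 t x * b3 t x) = 0 :=
    integral_eq_zero_of_hasDerivAt_of_integrable (f := fun x => 2 * (b1 t x * a2 t x - a1 t x * b2 t x))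
      (fun x => ((((h.dxb1 t x).fun_mul (h.dxa2 t x)).fun_sub
      ((h.dxa1 t x).fun_mul (h.dxb2 t x))).const_mul 2).congr_deriv (by ring))
      (n2.integrable t) (n4.integrable t)
  rw [← zero_add (∫ x, 2 * (a1 t x * g1 t x - b1 t x * f1 t x)), ← h2,
    ← integral_add (n2.integrable t) (n3.integrable t)]
  congr 1; ext x; ring

end Good

namespace Good
variable {p lam : ℝ} {a b a1 b1 a2 b2 a3 b3 f g f1 g1 : ℝ → ℝ → ℝ}

/-- The Morawetz weight. -/
def mor (a b : ℝ → ℝ → ℝ) (t x : ℝ) : ℝ :=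
  2 * (∫ y in Set.Iic x, (a t y ^ 2 + b t y ^ 2)) - ∫ y, (a t y ^ 2 + b t y ^ 2)

theorem mor_abs (h : Good p lam a b a1 b1 a2 b2 a3 b3 f g f1 g1) (t x : ℝ) :
    |mor a b t x| ≤ ∫ y, (a t y ^ 2 + b t y ^ 2) := by
  have h1 : 0 ≤ ∫ y in Set.Iic x, (a t y ^ 2 + b t y ^ 2) :=
    integral_nonneg (fun y => rho_nonneg a b t y)
  have h2 : ∫ y in Set.Iic x, (a t y ^ 2 + b t y ^ 2) ≤ ∫ y, (a t y ^ 2 + b t y ^ 2) :=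
    setIntegral_le_integral (h.nrho.integrable t) (Filter.Eventually.of_forall (rho_nonneg a b t))
  rw [abs_le, mor]
  constructor <;> linarith

theorem mor_bdd (h : Good p lam a b a1 b1 a2 b2 a3 b3 f g f1 g1) : NBdd (mor a b) := by
  intro T
  refine ⟨∫ y, (a 0 y ^ 2 + b 0 y ^ 2), integral_nonneg (fun y => rho_nonneg a b 0 y), ?_⟩
  intro t _ x
  rw [h.mass 0 t]
  exact h.mor_abs t x

theorem dxmor (h : Good p lam a b a1 b1 a2 b2 a3 b3 f g f1 g1) (t x : ℝ) :
    HasDerivAt (fun y => mor a b t y) (2 * (a t x ^ 2 + b t x ^ 2)) x := by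
  have hc := h.nrho.cx t
  have hi := h.nrho.integrable t
  have h1 : HasDerivAt (fun y => ∫ z in (0:ℝ)..y, (a t z ^ 2 + b t z ^ 2)) (a t x ^ 2 + b t x ^ 2) x :=
    intervalIntegral.integral_hasDerivAt_right (hc.intervalIntegrable _ _)
      hc.stronglyMeasurable.stronglyMeasurableAtFilter hc.continuousAt
  have h2 := ((h1.add_const (∫ z in Set.Iic (0:ℝ), (a t z ^ 2 + b t z ^ 2))).const_mul 2).sub_const
    (∫ y, (a t y ^ 2 + b t y ^ 2))
  refine h2.congr_of_eventuallyEq (Filter.Eventually.of_forall fun y => ?_)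
  have h3 := intervalIntegral.integral_Iic_sub_Iic (a := 0) (b := y) hi.integrableOn hi.integrableOn
  simp only [mor]
  rw [← h3]
  ring

theorem dtmor (h : Good p lam a b a1 b1 a2 b2 a3 b3 f g f1 g1) (t x : ℝ) :
    HasDerivAt (fun s => mor a b s x) (-4 * (a t x * b1 t x - b t x * a1 t x)) t := by
  have n1 : Nice (fun t x => 2 * (b t x * a2 t x - a t x * b2 t x)) :=
    ((h.nb.mul h.na2).sub (h.na.mul h.nb2)).const_mul 2
  have nW : Nice (fun t x => 2 * (b t x * a1 t x - a t x * b1 t x)) :=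
    ((h.nb.mul h.na1).sub (h.na.mul h.nb1)).const_mul 2
  have h1 := h.nrho.dec.hasDerivAt_integral n1.dec h.nrho.cx n1.cx h.dtrho (Set.Iic x) t
  have hd : ∀ x, HasDerivAt (fun x => 2 * (b t x * a1 t x - a t x * b1 t x))
      (2 * (b t x * a2 t x - a t x * b2 t x)) x := fun x =>
    ((((h.dxb t x).fun_mul (h.dxa1 t x)).fun_sub ((h.dxa t x).fun_mul (h.dxb1 t x))).const_mul
    2).congr_deriv (by ring)
  have h0 := tendsto_zero_of_hasDerivAt_of_integrableOn_Iic (a := x) (fun x _ => hd x)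
    (n1.integrable t).integrableOn (nW.integrable t).integrableOn
  have h2 := integral_Iic_of_hasDerivAt_of_tendsto' (a := x) (fun y _ => hd y)
    (n1.integrable t).integrableOn h0
  rw [h2] at h1
  have h3 := (h1.const_mul 2).sub_const (∫ y, (a t y ^ 2 + b t y ^ 2))
  refine (h3.congr_of_eventuallyEq (Filter.Eventually.of_forall fun y => ?_)).congr_deriv (by ring)
  simp only [mor]
  rw [h.mass y t]

/-- The Morawetz identity. -/
theorem morawetz (h : Good p lam a b a1 b1 a2 b2 a3 b3 f g f1 g1) (t : ℝ) :
    HasDerivAt (fun s => ∫ x, (a s x * b1 s x - b s x * a1 s x) * mor a b s x)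
      (2 * ((∫ x, (2 * (a t x * a1 t x + b t x * b1 t x)) ^ 2) +
        lam * ((p - 1) / (p + 1)) * ∫ x, (a t x ^ 2 + b t x ^ 2) ^ ((p + 3) / 2))) t := by
  set c := (p - 1) / (p + 1) with hc
  have hcm : ∀ t, Continuous (mor a b t) := fun t =>
    continuous_iff_continuousAt.2 (fun x => (h.dxmor t x).continuousAt)
  have nj : Nice (fun t x => a t x * b1 t x - b t x * a1 t x) :=
    (h.na.mul h.nb1).sub (h.nb.mul h.na1)
  have njt : Nice (fun t x => (-b2 t x + g t x) * b1 t x + a t x * (a3 t x - f1 t x)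
      - ((a2 t x - f t x) * a1 t x + b t x * (-b3 t x + g1 t x))) :=
    (((h.nb2.neg.add h.ng).mul h.nb1).add (h.na.mul (h.na3.sub h.nf1))).sub
      (((h.na2.sub h.nf).mul h.na1).add (h.nb.mul (h.nb3.neg.add h.ng1)))
  have dG : NDec (fun t x => (a t x * b1 t x - b t x * a1 t x) * mor a b t x) :=
    nj.dec.mul_bdd h.mor_bdd
  have cG : ∀ t, Continuous (fun x => (a t x * b1 t x - b t x * a1 t x) * mor a b t x) :=
    fun t => (nj.cx t).mul (hcm t)
  have nj2 : Nice (fun t x => (a t x * b1 t x - b t x * a1 t x) *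
      (-4 * (a t x * b1 t x - b t x * a1 t x))) := nj.mul (nj.const_mul _)
  have dG' : NDec (fun t x => ((-b2 t x + g t x) * b1 t x + a t x * (a3 t x - f1 t x)
      - ((a2 t x - f t x) * a1 t x + b t x * (-b3 t x + g1 t x))) * mor a b t x +
      (a t x * b1 t x - b t x * a1 t x) * (-4 * (a t x * b1 t x - b t x * a1 t x))) :=
    (njt.dec.mul_bdd h.mor_bdd).add nj2.dec
  have cG' : ∀ t, Continuous (fun x => ((-b2 t x + g t x) * b1 t x + a t x * (a3 t x - f1 t x)
      - ((a2 t x - f t x) * a1 t x + b t x * (-b3 t x + g1 t x))) * mor a b t x +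
      (a t x * b1 t x - b t x * a1 t x) * (-4 * (a t x * b1 t x - b t x * a1 t x))) :=
    fun t => ((njt.cx t).mul (hcm t)).add (nj2.cx t)
  have h1 := dG.hasDerivAt_integral dG' cG cG' (fun t x =>
    (((h.dta t x).fun_mul (h.dtb1 t x)).fun_sub ((h.dtb t x).fun_mul (h.dta1 t x))).fun_mul
      (h.dtmor t x)) Set.univ t
  simp only [Measure.restrict_univ] at h1
  refine h1.congr_deriv ?_
  -- the flux
  have nA : Nice (fun t x => (2 * (a t x * a1 t x + b t x * b1 t x)) ^ 2) :=
    (((h.na.mul h.na1).add (h.nb.mul h.nb1)).const_mul 2).sq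
  have nB : Nice (fun t x => (a t x ^ 2 + b t x ^ 2) ^ ((p + 3) / 2)) :=
    h.nrho.rpow (rho_nonneg a b) (by linarith [h.hp])
  have nAB : Nice (fun t x => 2 * ((2 * (a t x * a1 t x + b t x * b1 t x)) ^ 2 +
      lam * c * (a t x ^ 2 + b t x ^ 2) ^ ((p + 3) / 2))) :=
    (nA.add (nB.const_mul _)).const_mul 2
  have nPhi : Nice (fun t x => a1 t x ^ 2 + b1 t x ^ 2 - (a t x * a2 t x + b t x * b2 t x) +
      lam * c * (a t x ^ 2 + b t x ^ 2) ^ ((p + 1) / 2)) :=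
    ((h.na1.sq.add h.nb1.sq).sub ((h.na.mul h.na2).add (h.nb.mul h.nb2))).add (h.nQ.const_mul _)
  have nrr : Nice (fun t x => (a t x ^ 2 + b t x ^ 2) * (2 * (a t x * a1 t x + b t x * b1 t x))) :=
    h.nrho.mul (((h.na.mul h.na1).add (h.nb.mul h.nb1)).const_mul 2)
  have dW : NDec (fun t x => -((a1 t x ^ 2 + b1 t x ^ 2 - (a t x * a2 t x + b t x * b2 t x) +
      lam * c * (a t x ^ 2 + b t x ^ 2) ^ ((p + 1) / 2)) * mor a b t x) -
      (a t x ^ 2 + b t x ^ 2) * (2 * (a t x * a1 t x + b t x * b1 t x))) :=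
    (nPhi.dec.mul_bdd h.mor_bdd).neg.sub nrr.dec
  have cW : Continuous (fun x => -((a1 t x ^ 2 + b1 t x ^ 2 - (a t x * a2 t x + b t x * b2 t x) +
      lam * c * (a t x ^ 2 + b t x ^ 2) ^ ((p + 1) / 2)) * mor a b t x) -
      (a t x ^ 2 + b t x ^ 2) * (2 * (a t x * a1 t x + b t x * b1 t x))) :=
    ((nPhi.cx t).mul (hcm t)).neg.sub (nrr.cx t)
  have hcp : c * (p + 1) = p - 1 := by
    have := h.hp
    rw [hc]; field_simp
  have hWd : ∀ x, HasDerivAt (fun x => -((a1 t x ^ 2 + b1 t x ^ 2 - (a t x * a2 t x + b t x * b2 t x) +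
      lam * c * (a t x ^ 2 + b t x ^ 2) ^ ((p + 1) / 2)) * mor a b t x) -
      (a t x ^ 2 + b t x ^ 2) * (2 * (a t x * a1 t x + b t x * b1 t x)))
      ((((-b2 t x + g t x) * b1 t x + a t x * (a3 t x - f1 t x)
      - ((a2 t x - f t x) * a1 t x + b t x * (-b3 t x + g1 t x))) * mor a b t x +
      (a t x * b1 t x - b t x * a1 t x) * (-4 * (a t x * b1 t x - b t x * a1 t x))) -
      2 * ((2 * (a t x * a1 t x + b t x * b1 t x)) ^ 2 +
      lam * c * (a t x ^ 2 + b t x ^ 2) ^ ((p + 3) / 2))) x := by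
    intro x
    have e1 := (((h.dxa1 t x).fun_pow 2).fun_add ((h.dxb1 t x).fun_pow 2)).fun_sub
      (((h.dxa t x).fun_mul (h.dxa2 t x)).fun_add ((h.dxb t x).fun_mul (h.dxb2 t x)))
    have e2 := e1.fun_add ((h.dxQ t x).const_mul (lam * c))
    have e3 := (e2.fun_mul (h.dxmor t x)).fun_neg
    have e4 := (h.dxrho t x).fun_mul ((((h.dxa t x).fun_mul (h.dxa1 t x)).fun_add
      ((h.dxb t x).fun_mul (h.dxb1 t x))).const_mul 2)
    refine (e3.fun_sub e4).congr_deriv ?_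
    have hn := h.nonlin t x
    have hs : (a t x ^ 2 + b t x ^ 2) ^ ((p + 3) / 2) =
        (a t x ^ 2 + b t x ^ 2) ^ ((p - 1) / 2) * (a t x ^ 2 + b t x ^ 2) ^ 2 := by
      rw [show (p + 3) / 2 = (p + 1) / 2 + 1 by ring,
        Real.rpow_add_of_nonneg (by positivity) (by linarith [h.hp]) (by norm_num), Real.rpow_one,
        h.rpow_split]
      ring
    have hf := h.hf t x
    have hg := h.hg t x
    rw [hs, h.rpow_split]
    generalize (a t x ^ 2 + b t x ^ 2) ^ ((p - 1) / 2) = w at *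
    generalize mor a b t x = m at *
    push_cast
    have k2 : a t x * f1 t x + b t x * g1 t x =
      lam * ((p + 1) * w * (a t x * a1 t x + b t x * b1 t x)) - (a1 t x * f t x + b1 t x * g t x) := by
      linarith
    have k3 : g t x * b1 t x + f t x * a1 t x = lam * w * (a t x * a1 t x + b t x * b1 t x) := by
      rw [hf, hg]; ring
    linear_combination (m) * k2 - 2 * m * k3 - lam * w * (a t x * a1 t x + b t x * b1 t x) * m * hcp
  have hWi := integral_eq_zero_of_hasDerivAt_of_integrable hWd
    ((dG'.integrable t (cG' t)).sub (nAB.integrable t)) (dW.integrable t cW)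
  rw [integral_sub (dG'.integrable t (cG' t)) (nAB.integrable t), sub_eq_zero] at hWi
  rw [hWi, integral_const_mul, integral_add (nA.integrable t) ((nB.const_mul _).integrable t),
    integral_const_mul]

/-- bound on the Morawetz action -/
theorem mor_action (h : Good p lam a b a1 b1 a2 b2 a3 b3 f g f1 g1) (t : ℝ) :
    |∫ x, (a t x * b1 t x - b t x * a1 t x) * mor a b t x| ≤
      Real.sqrt (∫ x, (a 0 x ^ 2 + b 0 x ^ 2)) ^ 3 * Real.sqrt (∫ x, (a1 t x ^ 2 + b1 t x ^ 2)) := by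
  rw [h.mass 0 t]
  have nj : Nice (fun t x => a t x * b1 t x - b t x * a1 t x) :=
    (h.na.mul h.nb1).sub (h.nb.mul h.na1)
  have nk : Nice (fun t x => a1 t x ^ 2 + b1 t x ^ 2) := h.na1.sq.add h.nb1.sq
  set M := ∫ x, (a t x ^ 2 + b t x ^ 2) with hM
  set G := ∫ x, (a1 t x ^ 2 + b1 t x ^ 2) with hG
  have hM0 : 0 ≤ M := integral_nonneg (rho_nonneg a b t)
  have hG0 : 0 ≤ G := integral_nonneg (rho_nonneg a1 b1 t)
  set X := ∫ x, |a t x * b1 t x - b t x * a1 t x| with hX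
  have hX0 : 0 ≤ X := integral_nonneg (fun x => abs_nonneg _)
  have hXi : Integrable (fun x => |a t x * b1 t x - b t x * a1 t x|) := (nj.integrable t).abs
  have h1 : |∫ x, (a t x * b1 t x - b t x * a1 t x) * mor a b t x| ≤ X * M := by
    rw [hX, ← integral_mul_const]
    refine norm_integral_le_of_norm_le (f := fun x => (a t x * b1 t x - b t x * a1 t x) * mor a b t x)
      (hXi.mul_const M) (Filter.Eventually.of_forall fun x => ?_)
    rw [Real.norm_eq_abs, abs_mul]
    exact mul_le_mul_of_nonneg_left (h.mor_abs t x) (abs_nonneg _)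
  have h2 : ∀ s : ℝ, 0 ≤ M * (s * s) + (-2 * X) * s + G := by
    intro s
    have e : M * (s * s) + (-2 * X) * s + G = ∫ x, ((s * s) * (a t x ^ 2 + b t x ^ 2) -
        (2 * s) * |a t x * b1 t x - b t x * a1 t x| + (a1 t x ^ 2 + b1 t x ^ 2)) := by
      have i1 : Integrable (fun x => (s * s) * (a t x ^ 2 + b t x ^ 2)) :=
        (h.nrho.integrable t).const_mul _
      have i2 : Integrable (fun x => (2 * s) * |a t x * b1 t x - b t x * a1 t x|) := hXi.const_mul _
      have i3 : Integrable (fun x => (s * s) * (a t x ^ 2 + b t x ^ 2) -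
        (2 * s) * |a t x * b1 t x - b t x * a1 t x|) := i1.sub i2
      rw [integral_add i3 (nk.integrable t), integral_sub i1 i2, integral_const_mul, integral_const_mul]
      ring
    rw [e]
    refine integral_nonneg (fun x => ?_)
    rcases abs_choice (a t x * b1 t x - b t x * a1 t x) with e | e
    · simp only [e, Pi.zero_apply]
      nlinarith [sq_nonneg (s * a t x - b1 t x), sq_nonneg (s * b t x + a1 t x)]
    · simp only [e, Pi.zero_apply]
      nlinarith [sq_nonneg (s * a t x + b1 t x), sq_nonneg (s * b t x - a1 t x)]
  have h3 := discrim_le_zero h2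
  have h4 : X ≤ Real.sqrt M * Real.sqrt G := by
    rw [← Real.sqrt_mul hM0]
    apply Real.le_sqrt_of_sq_le
    rw [discrim] at h3
    nlinarith
  calc _ ≤ X * M := h1
    _ ≤ (Real.sqrt M * Real.sqrt G) * M := by gcongr
    _ = _ := by
      have := Real.sq_sqrt hM0
      rw [pow_succ, this]; ring

end Good

/-! ### Real-variable lemmas -/

/-- If `Y` obeys `|Y'| ≤ c Y^{1+q}` and is large only where the integrable `A` is at least one, then
`Y` is bounded. -/
theorem bounded_of_concentration {Y Y' A : ℝ → ℝ} {c q K : ℝ} (hq : 0 < q) (hc : 0 ≤ c)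
    (hY1 : ∀ t, 1 ≤ Y t) (hd : ∀ t, HasDerivAt Y (Y' t) t) (hb : ∀ t, |Y' t| ≤ c * Y t ^ (1 + q))
    (hA : Integrable A) (hK : 1 ≤ K) (hYA : ∀ t, K ≤ Y t → 1 ≤ A t) :
    ∃ C, ∀ t, Y t ≤ C := by
  have hYc : Continuous Y := continuous_iff_continuousAt.2 (fun t => (hd t).continuousAt)
  have hL : 0 < q * c + 1 := by positivity
  set L := q * c + 1 with hLdef
  set d := K ^ (-q) / 2 with hdd
  have hKq : 0 < K ^ (-q) := Real.rpow_pos_of_pos (by linarith) _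
  have hd0 : 0 < d := by positivity
  set r := d / L with hr
  have hr0 : 0 < r := by positivity
  -- Lipschitz
  have hlip : ∀ s t, |Y s ^ (-q) - Y t ^ (-q)| ≤ L * |s - t| := by
    intro s t
    have h1 : ∀ t ∈ (Set.univ : Set ℝ), HasDerivWithinAt (fun t => Y t ^ (-q))
        (Y' t * (-q) * Y t ^ (-q - 1)) Set.univ t := fun t _ =>
      ((hd t).rpow_const (Or.inl (by linarith [hY1 t] : Y t ≠ 0))).hasDerivWithinAt
    have h2 : ∀ t ∈ (Set.univ : Set ℝ), ‖Y' t * (-q) * Y t ^ (-q - 1)‖ ≤ L := by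
      intro t _
      have hp0 : 0 < Y t := by linarith [hY1 t]
      rw [Real.norm_eq_abs, abs_mul, abs_mul, abs_neg, abs_of_pos hq,
        abs_of_pos (Real.rpow_pos_of_pos hp0 _)]
      have : Y t ^ (1 + q) * Y t ^ (-q - 1) = 1 := by
        rw [← Real.rpow_add hp0, show 1 + q + (-q - 1) = 0 by ring, Real.rpow_zero]
      have h3 := hb t
      have h4 := Real.rpow_pos_of_pos hp0 (-q - 1)
      calc |Y' t| * q * Y t ^ (-q - 1) ≤ (c * Y t ^ (1 + q)) * q * Y t ^ (-q - 1) := by gcongr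
        _ = q * c * (Y t ^ (1 + q) * Y t ^ (-q - 1)) := by ring
        _ = q * c := by rw [this, mul_one]
        _ ≤ L := by rw [hLdef]; linarith
    have := convex_univ.norm_image_sub_le_of_norm_hasDerivWithin_le h1 h2 (Set.mem_univ t)
      (Set.mem_univ s)
    simpa [Real.norm_eq_abs] using this
  -- small psi forces a lot of A
  have hbig : ∀ t, Y t ^ (-q) ≤ d → 2 * r ≤ ∫ s in (t - r)..(t + r), A s := by
    intro t ht
    have h1 : ∀ s ∈ Set.Icc (t - r) (t + r), (1:ℝ) ≤ A s := by
      intro s hs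
      apply hYA
      by_contra hlt
      push Not at hlt
      have h2 := Real.rpow_lt_rpow_of_neg (by linarith [hY1 s] : 0 < Y s) hlt (by linarith : -q < 0)
      have h3 := hlip s t
      have h4 : |s - t| ≤ r := by rw [abs_le]; constructor <;> linarith [hs.1, hs.2]
      have h5 : L * |s - t| ≤ d := by
        calc L * |s - t| ≤ L * r := by gcongr
          _ = d := by rw [hr]; field_simp
      have h6 := (abs_le.1 (h3.trans h5)).2
      have : K ^ (-q) = 2 * d := by rw [hdd]; ring
      linarith
    have h2 := intervalIntegral.integral_mono_on (a := t - r) (b := t + r) (f := fun _ => (1:ℝ))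
      (g := A) (by linarith) (by simp) hA.intervalIntegrable h1
    simp at h2
    linarith
  have htop : Filter.Tendsto (fun t => ∫ s in (t - r)..(t + r), A s) Filter.atTop (nhds 0) := by
    have h1 := intervalIntegral_tendsto_integral_Ioi 0 hA.integrableOn
      (Filter.tendsto_atTop_add_const_right Filter.atTop r Filter.tendsto_id)
    have h2 := intervalIntegral_tendsto_integral_Ioi 0 hA.integrableOn
      (Filter.tendsto_atTop_add_const_right Filter.atTop (-r) Filter.tendsto_id)
    have h3 := h1.sub h2
    rw [sub_self] at h3
    refine h3.congr (fun t => ?_)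
    simp only [id]
    rw [intervalIntegral.integral_interval_sub_left hA.intervalIntegrable hA.intervalIntegrable,
      sub_eq_add_neg]
  have hbot : Filter.Tendsto (fun t => ∫ s in (t - r)..(t + r), A s) Filter.atBot (nhds 0) := by
    have h1 := intervalIntegral_tendsto_integral_Iic 0 hA.integrableOn
      (Filter.tendsto_atBot_add_const_right Filter.atBot r Filter.tendsto_id)
    have h2 := intervalIntegral_tendsto_integral_Iic 0 hA.integrableOn
      (Filter.tendsto_atBot_add_const_right Filter.atBot (-r) Filter.tendsto_id)
    have h3 := h2.sub h1
    rw [sub_self] at h3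
    refine h3.congr (fun t => ?_)
    simp only [id]
    have h4 := intervalIntegral.integral_add_adjacent_intervals (μ := volume) (f := A) (a := t - r)
      (b := t + r) (c := 0) hA.intervalIntegrable hA.intervalIntegrable
    rw [← sub_eq_add_neg]
    linarith
  obtain ⟨R1, hR1⟩ := Filter.eventually_atTop.1 (htop.eventually (gt_mem_nhds (by linarith : 0 < 2 * r)))
  obtain ⟨R2, hR2⟩ := Filter.eventually_atBot.1 (hbot.eventually (gt_mem_nhds (by linarith : 0 < 2 * r)))
  obtain ⟨C, hC⟩ := (isCompact_Icc (a := R2) (b := R1)).bddAbove_image hYc.continuousOn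
  refine ⟨max C (d ^ (-q)⁻¹), fun t => ?_⟩
  by_cases ht : t ∈ Set.Icc R2 R1
  · exact le_max_of_le_left (hC (Set.mem_image_of_mem Y ht))
  · have h1 : d < Y t ^ (-q) := by
      by_contra hle
      push Not at hle
      have h2 := hbig t hle
      rcases le_total R1 t with h3 | h3
      · linarith [hR1 t h3]
      · have : t ≤ R2 := by
          by_contra h4
          push Not at h4
          exact ht ⟨h4.le, h3⟩
        linarith [hR2 t this]
    apply le_max_of_le_right
    by_contra hlt
    push Not at hlt
    have h2 := Real.rpow_lt_rpow_of_neg (Real.rpow_pos_of_pos hd0 _) hlt (by linarith : -q < 0)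
    rw [← Real.rpow_mul hd0.le, inv_mul_cancel₀ (by linarith), Real.rpow_one] at h2
    linarith

theorem final_real {A h : ℝ → ℝ} (cA : Continuous A) (ch : Continuous h) (hA : ∀ t, 0 ≤ A t)
    {R : ℝ} (H : ∀ T, |∫ t in (-T)..T, (A t + h t)| ≤ R)
    (hI : (∀ t, 0 ≤ h t) ∨ ((∀ t, h t ≤ 0) ∧ Integrable A)) :
    (∫ t, A t) + ∫ t, h t ≤ R := by
  have t1 : Filter.Tendsto (fun T : ℝ => -T) Filter.atTop Filter.atBot := Filter.tendsto_neg_atTop_atBot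
  have t2 : Filter.Tendsto (fun T : ℝ => T) Filter.atTop Filter.atTop := Filter.tendsto_id
  have hs : ∀ T, ∫ t in (-T)..T, (A t + h t) = (∫ t in (-T)..T, A t) + ∫ t in (-T)..T, h t :=
    fun T => intervalIntegral.integral_add (cA.intervalIntegrable _ _) (ch.intervalIntegrable _ _)
  have both : Integrable A ∧ Integrable h := by
    rcases hI with h0 | ⟨h0, hAi⟩
    · constructor
      · refine integrable_of_intervalIntegral_norm_bounded R
          (fun T => (cA.integrableOn_Icc).mono_set Set.Ioc_subset_Icc_self) t1 t2 ?_
        filter_upwards [Filter.eventually_ge_atTop 0] with T hT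
        have e : ∀ t, ‖A t‖ = A t := fun t => by rw [Real.norm_eq_abs, abs_of_nonneg (hA t)]
        simp only [e]
        have := intervalIntegral.integral_nonneg (μ := volume) (by linarith : -T ≤ T) (fun t _ => h0 t)
        have := (abs_le.1 (H T)).2
        rw [hs] at this
        linarith
      · refine integrable_of_intervalIntegral_norm_bounded R
          (fun T => (ch.integrableOn_Icc).mono_set Set.Ioc_subset_Icc_self) t1 t2 ?_
        filter_upwards [Filter.eventually_ge_atTop 0] with T hT
        have e : ∀ t, ‖h t‖ = h t := fun t => by rw [Real.norm_eq_abs, abs_of_nonneg (h0 t)]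
        simp only [e]
        have := intervalIntegral.integral_nonneg (μ := volume) (by linarith : -T ≤ T) (fun t _ => hA t)
        have := (abs_le.1 (H T)).2
        rw [hs] at this
        linarith
    · refine ⟨hAi, integrable_of_intervalIntegral_norm_bounded (R + ∫ t, A t)
          (fun T => (ch.integrableOn_Icc).mono_set Set.Ioc_subset_Icc_self) t1 t2 ?_⟩
      filter_upwards [Filter.eventually_ge_atTop 0] with T hT
      have e : ∀ t, ‖h t‖ = - h t := fun t => by rw [Real.norm_eq_abs, abs_of_nonpos (h0 t)]
      simp only [e, intervalIntegral.integral_neg]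
      have h1 : ∫ t in (-T)..T, A t ≤ ∫ t, A t := by
        rw [intervalIntegral.integral_of_le (by linarith)]
        exact setIntegral_le_integral hAi (Filter.Eventually.of_forall hA)
      have := (abs_le.1 (H T)).1
      rw [hs] at this
      linarith
  rw [← integral_add both.1 both.2]
  refine le_of_tendsto (intervalIntegral_tendsto_integral (both.1.add both.2) t1 t2)
    (Filter.Eventually.of_forall (fun T => (le_abs_self _).trans (H T)))

namespace Good
variable {p lam : ℝ} {a b a1 b1 a2 b2 a3 b3 f g f1 g1 : ℝ → ℝ → ℝ}

theorem rho_le (h : Good p lam a b a1 b1 a2 b2 a3 b3 f g f1 g1) (t x : ℝ) :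
    a t x ^ 2 + b t x ^ 2 ≤ (∫ y, (a t y ^ 2 + b t y ^ 2)) + ∫ y, (a1 t y ^ 2 + b1 t y ^ 2) := by
  have nk : Nice (fun t x => a1 t x ^ 2 + b1 t x ^ 2) := h.na1.sq.add h.nb1.sq
  have n1 : Nice (fun t x => 2 * (a t x * a1 t x + b t x * b1 t x)) :=
    ((h.na.mul h.na1).add (h.nb.mul h.nb1)).const_mul 2
  have := pointwise_le (k := fun y => (a t y ^ 2 + b t y ^ 2) + (a1 t y ^ 2 + b1 t y ^ 2))
    (h.dxrho t) (h.nrho.integrable t) (n1.integrable t) ((h.nrho.add nk).integrable t)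
    (fun y => by nlinarith [sq_nonneg (a t y - a1 t y), sq_nonneg (b t y - b1 t y)])
    (fun y => by positivity) x
  rwa [integral_add (h.nrho.integrable t) (nk.integrable t)] at this

theorem rho_le_of_A (h : Good p lam a b a1 b1 a2 b2 a3 b3 f g f1 g1) (t : ℝ)
    (hA : ∫ x, (2 * (a t x * a1 t x + b t x * b1 t x)) ^ 2 ≤ 1) (x : ℝ) :
    a t x ^ 2 + b t x ^ 2 ≤ (∫ y, (a t y ^ 2 + b t y ^ 2)) + 1 := by
  set M := ∫ y, (a t y ^ 2 + b t y ^ 2) with hM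
  have hM0 : 0 ≤ M := integral_nonneg (rho_nonneg a b t)
  have hbdd : BddAbove (Set.range (fun x => a t x ^ 2 + b t x ^ 2)) :=
    ⟨_, by rintro _ ⟨x, rfl⟩; exact h.rho_le t x⟩
  set S := ⨆ x, (a t x ^ 2 + b t x ^ 2) with hS
  have hxS : ∀ x, a t x ^ 2 + b t x ^ 2 ≤ S := fun x => le_ciSup hbdd x
  have hS0 : 0 ≤ S := (rho_nonneg a b t 0).trans (hxS 0)
  have n1 : Nice (fun t x => 2 * (a t x * a1 t x + b t x * b1 t x)) :=
    ((h.na.mul h.na1).add (h.nb.mul h.nb1)).const_mul 2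
  have h1 : ∀ x, (a t x ^ 2 + b t x ^ 2) ^ 2 ≤ S * M + 1 := by
    intro x
    have n2 : Nice (fun t x => 2 * ((a t x ^ 2 + b t x ^ 2) *
      (2 * (a t x * a1 t x + b t x * b1 t x)))) := (h.nrho.mul n1).const_mul 2
    have := pointwise_le (g := fun y => (a t y ^ 2 + b t y ^ 2) ^ 2)
      (g' := fun x => 2 * ((a t x ^ 2 + b t x ^ 2) * (2 * (a t x * a1 t x + b t x * b1 t x))))
      (k := fun y => S * (a t y ^ 2 + b t y ^ 2) + (2 * (a t y * a1 t y + b t y * b1 t y)) ^ 2)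
      (fun y => ((h.dxrho t y).fun_pow 2).congr_deriv (by push_cast; ring))
      (h.nrho.sq.integrable t) (n2.integrable t) (((h.nrho.const_mul S).add n1.sq).integrable t)
      (fun y => by
        have h1 := hxS y
        have h2 := rho_nonneg a b t y
        nlinarith [sq_nonneg ((a t y ^ 2 + b t y ^ 2) - (2 * (a t y * a1 t y + b t y * b1 t y)))])
      (fun y => by positivity) x
    rw [integral_add ((h.nrho.const_mul S).integrable t) (n1.sq.integrable t),
      integral_const_mul] at this
    linarith
  have h2 : S ≤ Real.sqrt (S * M + 1) := ciSup_le (fun x => Real.le_sqrt_of_sq_le (h1 x))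
  have h3 : S ^ 2 ≤ S * M + 1 := by
    have := Real.sq_sqrt (by positivity : 0 ≤ S * M + 1)
    rw [← this]
    gcongr
  refine (hxS x).trans ?_
  by_contra hlt
  push Not at hlt
  nlinarith

theorem kin_bdd_of_A (h : Good p lam a b a1 b1 a2 b2 a3 b3 f g f1 g1)
    (hA : Integrable (fun t => ∫ x, (2 * (a t x * a1 t x + b t x * b1 t x)) ^ 2)) :
    ∃ C, ∀ t, ∫ x, (a1 t x ^ 2 + b1 t x ^ 2) ≤ C := by
  have hp := h.hp
  have nk : Nice (fun t x => a1 t x ^ 2 + b1 t x ^ 2) := h.na1.sq.add h.nb1.sq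
  set M := ∫ y, (a 0 y ^ 2 + b 0 y ^ 2) with hM
  have hM0 : 0 ≤ M := integral_nonneg (rho_nonneg a b 0)
  set E := (∫ x, (a1 0 x ^ 2 + b1 0 x ^ 2)) +
      2 * lam / (p + 1) * ∫ x, (a 0 x ^ 2 + b 0 x ^ 2) ^ ((p + 1) / 2) with hE
  set K0 := |E| + |2 * lam / (p + 1)| * ((M + 1) ^ ((p - 1) / 2) * M) with hK0
  have hK00 : 0 ≤ K0 := by positivity
  have hG0 : ∀ t, 0 ≤ ∫ x, (a1 t x ^ 2 + b1 t x ^ 2) := fun t => integral_nonneg (rho_nonneg a1 b1 t)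
  have hsmall : ∀ t, ∫ x, (2 * (a t x * a1 t x + b t x * b1 t x)) ^ 2 ≤ 1 →
      ∫ x, (a1 t x ^ 2 + b1 t x ^ 2) ≤ K0 := by
    intro t ht
    have h1 := h.rho_le_of_A t ht
    rw [h.mass t 0, ← hM] at h1
    have h2 : ∫ x, (a t x ^ 2 + b t x ^ 2) ^ ((p + 1) / 2) ≤ (M + 1) ^ ((p - 1) / 2) * M := by
      rw [hM, h.mass 0 t, ← integral_const_mul]
      refine integral_mono (h.nQ.integrable t) ((h.nrho.integrable t).const_mul _) (fun x => ?_)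
      simp only
      rw [h.rpow_split]
      refine mul_le_mul_of_nonneg_right ?_ (rho_nonneg a b t x)
      rw [← h.mass 0 t]
      exact Real.rpow_le_rpow (rho_nonneg a b t x) (h1 x) (by linarith)
    have h3 : 0 ≤ ∫ x, (a t x ^ 2 + b t x ^ 2) ^ ((p + 1) / 2) :=
      integral_nonneg (fun x => Real.rpow_nonneg (rho_nonneg a b t x) _)
    have h4 := h.energy t 0
    rw [← hE] at h4
    have h5 : -(2 * lam / (p + 1) * ∫ x, (a t x ^ 2 + b t x ^ 2) ^ ((p + 1) / 2)) ≤
        |2 * lam / (p + 1)| * ((M + 1) ^ ((p - 1) / 2) * M) := by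
      refine (neg_le_abs _).trans ?_
      rw [abs_mul, abs_of_nonneg h3]
      gcongr
    have := le_abs_self E
    linarith
  obtain ⟨C, hC⟩ := bounded_of_concentration
    (Y := fun t => M + (∫ x, (a1 t x ^ 2 + b1 t x ^ 2)) + 1)
    (Y' := fun t => ∫ x, 2 * (a1 t x * g1 t x - b1 t x * f1 t x))
    (c := 4 * |lam| * p) (q := (p - 1) / 2) (K := M + K0 + 2)
    (by linarith) (by positivity) (fun t => by linarith [hG0 t])
    (fun t => ((h.kin_deriv t).const_add M).add_const 1)
    (fun t => by
      set G := ∫ x, (a1 t x ^ 2 + b1 t x ^ 2) with hG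
      have hG' : 0 ≤ G := hG0 t
      have hY : 0 < M + G + 1 := by linarith
      have h1 : |∫ x, 2 * (a1 t x * g1 t x - b1 t x * f1 t x)| ≤
          ∫ x, 4 * |lam| * p * (M + G + 1) ^ ((p - 1) / 2) * (a1 t x ^ 2 + b1 t x ^ 2) := by
        refine norm_integral_le_of_norm_le (f := fun x => 2 * (a1 t x * g1 t x - b1 t x * f1 t x))
          ((nk.integrable t).const_mul _) (Filter.Eventually.of_forall fun x => ?_)
        have k1 := h.f1_le t x
        have k2 := h.g1_le t x
        have k3 : (a t x ^ 2 + b t x ^ 2) ^ ((p - 1) / 2) ≤ (M + G + 1) ^ ((p - 1) / 2) := by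
          refine Real.rpow_le_rpow (rho_nonneg a b t x) ?_ (by linarith)
          have := h.rho_le t x
          rw [h.mass t 0, ← hM, ← hG] at this
          linarith
        have k4 : |lam| * p * (a t x ^ 2 + b t x ^ 2) ^ ((p - 1) / 2) * (|a1 t x| + |b1 t x|) ≤
            |lam| * p * (M + G + 1) ^ ((p - 1) / 2) * (|a1 t x| + |b1 t x|) := by gcongr
        have k5 : 0 ≤ |lam| * p * (M + G + 1) ^ ((p - 1) / 2) := by positivity
        generalize hw : |lam| * p * (M + G + 1) ^ ((p - 1) / 2) = w at *
        rw [Real.norm_eq_abs, abs_mul, abs_two]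
        calc 2 * |a1 t x * g1 t x - b1 t x * f1 t x|
            ≤ 2 * (|a1 t x| * |g1 t x| + |b1 t x| * |f1 t x|) := by
              gcongr; rw [← abs_mul, ← abs_mul]; exact abs_sub _ _
          _ ≤ 2 * (|a1 t x| * (w * (|a1 t x| + |b1 t x|)) + |b1 t x| * (w * (|a1 t x| + |b1 t x|))) := by
              gcongr
              · exact k2.trans k4
              · exact k1.trans k4
          _ = 2 * w * (|a1 t x| + |b1 t x|) ^ 2 := by ring
          _ ≤ 2 * w * (2 * (|a1 t x| ^ 2 + |b1 t x| ^ 2)) := by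
              gcongr; nlinarith [sq_nonneg (|a1 t x| - |b1 t x|)]
          _ = 4 * w * (a1 t x ^ 2 + b1 t x ^ 2) := by rw [sq_abs, sq_abs]; ring
          _ = _ := by rw [← hw]; ring
      rw [integral_const_mul (4 * |lam| * p * (M + G + 1) ^ ((p - 1) / 2)), ← hG] at h1
      refine h1.trans ?_
      rw [Real.rpow_add hY, Real.rpow_one]
      have k6 : 0 ≤ 4 * |lam| * p * (M + G + 1) ^ ((p - 1) / 2) := by positivity
      calc _ ≤ 4 * |lam| * p * (M + G + 1) ^ ((p - 1) / 2) * (M + G + 1) := by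
            apply mul_le_mul_of_nonneg_left _ k6; linarith
        _ = _ := by ring)
    hA (by linarith) (fun t ht => by
      by_contra hlt
      push Not at hlt
      have := hsmall t hlt.le
      linarith)
  exact ⟨C, fun t => by linarith [hC t]⟩

/-- The inequality in real coordinates. -/
theorem main (h : Good p lam a b a1 b1 a2 b2 a3 b3 f g f1 g1) :
    (∫ t, ∫ x, (2 * (a t x * a1 t x + b t x * b1 t x)) ^ 2) +
      lam * ((p - 1) / (p + 1)) * (∫ t, ∫ x, (a t x ^ 2 + b t x ^ 2) ^ ((p + 3) / 2)) ≤
    Real.sqrt (∫ x, (a 0 x ^ 2 + b 0 x ^ 2)) ^ 3 *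
      ⨆ t, Real.sqrt (∫ x, (a1 t x ^ 2 + b1 t x ^ 2)) := by
  have hp := h.hp
  have nA : Nice (fun t x => (2 * (a t x * a1 t x + b t x * b1 t x)) ^ 2) :=
    (((h.na.mul h.na1).add (h.nb.mul h.nb1)).const_mul 2).sq
  have nB : Nice (fun t x => (a t x ^ 2 + b t x ^ 2) ^ ((p + 3) / 2)) :=
    h.nrho.rpow (rho_nonneg a b) (by linarith [h.hp])
  have hA0 : ∀ t, 0 ≤ ∫ x, (2 * (a t x * a1 t x + b t x * b1 t x)) ^ 2 :=
    fun t => integral_nonneg (fun x => sq_nonneg _)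
  have hB0 : ∀ t, 0 ≤ ∫ x, (a t x ^ 2 + b t x ^ 2) ^ ((p + 3) / 2) :=
    fun t => integral_nonneg (fun x => Real.rpow_nonneg (rho_nonneg a b t x) _)
  have hc0 : 0 ≤ (p - 1) / (p + 1) := div_nonneg (by linarith) (by linarith)
  have cA := nA.continuous_integral
  have cB := nB.continuous_integral
  have hR0 : 0 ≤ Real.sqrt (∫ x, (a 0 x ^ 2 + b 0 x ^ 2)) ^ 3 *
      ⨆ t, Real.sqrt (∫ x, (a1 t x ^ 2 + b1 t x ^ 2)) :=
    mul_nonneg (by positivity) (Real.iSup_nonneg (fun t => Real.sqrt_nonneg _))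
  set R := Real.sqrt (∫ x, (a 0 x ^ 2 + b 0 x ^ 2)) ^ 3 *
      ⨆ t, Real.sqrt (∫ x, (a1 t x ^ 2 + b1 t x ^ 2)) with hR
  have key : (∃ C, ∀ t, ∫ x, (a1 t x ^ 2 + b1 t x ^ 2) ≤ C) → ∀ T : ℝ,
      |∫ t in (-T)..T, ((∫ x, (2 * (a t x * a1 t x + b t x * b1 t x)) ^ 2) +
        lam * ((p - 1) / (p + 1)) * (∫ x, (a t x ^ 2 + b t x ^ 2) ^ ((p + 3) / 2)))| ≤ R := by
    rintro ⟨C, hC⟩ T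
    have hbdd : BddAbove (Set.range (fun t => Real.sqrt (∫ x, (a1 t x ^ 2 + b1 t x ^ 2)))) :=
      ⟨Real.sqrt C, by rintro _ ⟨t, rfl⟩; exact Real.sqrt_le_sqrt (hC t)⟩
    have hI : ∀ t, |∫ x, (a t x * b1 t x - b t x * a1 t x) * mor a b t x| ≤ R := fun t =>
      (h.mor_action t).trans (mul_le_mul_of_nonneg_left (le_ciSup hbdd t) (by positivity))
    have h1 := intervalIntegral.integral_eq_sub_of_hasDerivAt (a := -T) (b := T)
      (fun t _ => h.morawetz t)
      (((cA.add (cB.const_mul (lam * ((p - 1) / (p + 1))))).const_mul 2).intervalIntegrable _ _)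
    rw [intervalIntegral.integral_const_mul] at h1
    have h2 := abs_le.1 (hI T)
    have h3 := abs_le.1 (hI (-T))
    rw [abs_le]
    constructor <;> linarith [h2.1, h2.2, h3.1, h3.2]
  rcases le_or_gt 0 lam with hl | hl
  · rw [← integral_const_mul]
    refine final_real cA (cB.const_mul _) hA0 (key ?_) (Or.inl fun t => ?_)
    · refine ⟨(∫ x, (a1 0 x ^ 2 + b1 0 x ^ 2)) +
        2 * lam / (p + 1) * ∫ x, (a 0 x ^ 2 + b 0 x ^ 2) ^ ((p + 1) / 2), fun t => ?_⟩
      · have h4 := h.energy t 0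
        have h3 : 0 ≤ ∫ x, (a t x ^ 2 + b t x ^ 2) ^ ((p + 1) / 2) :=
          integral_nonneg (fun x => Real.rpow_nonneg (rho_nonneg a b t x) _)
        have h5 : 0 ≤ 2 * lam / (p + 1) := by positivity
        have h6 := mul_nonneg h5 h3
        linarith
    · exact mul_nonneg (mul_nonneg hl hc0) (hB0 t)
  · by_cases hAi : Integrable (fun t => ∫ x, (2 * (a t x * a1 t x + b t x * b1 t x)) ^ 2)
    · rw [← integral_const_mul]
      refine final_real cA (cB.const_mul _) hA0 (key (h.kin_bdd_of_A hAi)) (Or.inr ⟨fun t => ?_, hAi⟩)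
      exact mul_nonpos_of_nonpos_of_nonneg (mul_nonpos_of_nonpos_of_nonneg hl.le hc0) (hB0 t)
    · rw [integral_undef hAi, zero_add]
      refine le_trans ?_ hR0
      exact mul_nonpos_of_nonpos_of_nonneg (mul_nonpos_of_nonpos_of_nonneg hl.le hc0)
        (integral_nonneg hB0)

end Good

/-! ### From the complex solution to real coordinates -/

/-- directional derivative -/
def dird (v : ℝ × ℝ) (V : ℝ × ℝ → ℂ) (q : ℝ × ℝ) : ℂ := fderiv ℝ V q v

theorem dird_smooth (v : ℝ × ℝ) {V : ℝ × ℝ → ℂ} (hV : ContDiff ℝ (⊤ : ℕ∞) V) :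
    ContDiff ℝ (⊤ : ℕ∞) (dird v V) := by
  unfold dird
  exact (hV.fderiv_right (m := (⊤ : ℕ∞)) (by norm_cast)).clm_apply contDiff_const

theorem dird_x {V : ℝ × ℝ → ℂ} (hV : ContDiff ℝ (⊤ : ℕ∞) V) (t x : ℝ) :
    HasDerivAt (fun y => V (t, y)) (dird (0, 1) V (t, x)) x := by
  have h1 : HasFDerivAt V (fderiv ℝ V (t, x)) (t, x) :=
    (hV.differentiable (by simp) (t, x)).hasFDerivAt
  have h2 : HasDerivAt (fun y : ℝ => (t, y)) ((0 : ℝ), (1 : ℝ)) x :=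
    (hasDerivAt_const x t).prodMk (hasDerivAt_id x)
  exact h1.comp_hasDerivAt x h2

theorem dird_t {V : ℝ × ℝ → ℂ} (hV : ContDiff ℝ (⊤ : ℕ∞) V) (t x : ℝ) :
    HasDerivAt (fun s => V (s, x)) (dird (1, 0) V (t, x)) t := by
  have h1 : HasFDerivAt V (fderiv ℝ V (t, x)) (t, x) :=
    (hV.differentiable (by simp) (t, x)).hasFDerivAt
  have h2 : HasDerivAt (fun s : ℝ => (s, x)) ((1 : ℝ), (0 : ℝ)) t :=
    (hasDerivAt_id t).prodMk (hasDerivAt_const t x)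
  exact h1.comp_hasDerivAt t h2

theorem dird_comm {V : ℝ × ℝ → ℂ} (hV : ContDiff ℝ (⊤ : ℕ∞) V) (v w q : ℝ × ℝ) :
    dird v (dird w V) q = dird w (dird v V) q := by
  have hd : DifferentiableAt ℝ (fderiv ℝ V) q :=
    (hV.fderiv_right (m := (⊤ : ℕ∞)) (by norm_cast)).differentiable (by simp) q
  have key : ∀ v w, dird v (dird w V) q = fderiv ℝ (fderiv ℝ V) q v w := by
    intro v w
    have : HasFDerivAt (dird w V) ((ContinuousLinearMap.apply ℝ ℂ w).comp
        (fderiv ℝ (fderiv ℝ V) q)) q :=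
      (ContinuousLinearMap.apply ℝ ℂ w).hasFDerivAt.comp q hd.hasFDerivAt
    simp only [dird] at this ⊢
    rw [this.fderiv]
    simp
  rw [key, key]
  exact (hV.contDiffAt.isSymmSndFDerivAt (by rw [minSmoothness_of_isRCLikeNormedField]; exact WithTop.coe_le_coe.2 (le_top : (2:ℕ∞) ≤ ⊤))) v w

theorem hasDerivAt_re {F : ℝ → ℂ} {F' : ℂ} {x : ℝ} (h : HasDerivAt F F' x) :
    HasDerivAt (fun y => (F y).re) F'.re x :=
  Complex.reCLM.hasFDerivAt.comp_hasDerivAt x h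

theorem hasDerivAt_im {F : ℝ → ℂ} {F' : ℂ} {x : ℝ} (h : HasDerivAt F F' x) :
    HasDerivAt (fun y => (F y).im) F'.im x :=
  Complex.imCLM.hasFDerivAt.comp_hasDerivAt x h

theorem nice_of {V : ℝ × ℝ → ℂ} (hV : ContDiff ℝ (⊤ : ℕ∞) V)
    (hd : ∀ (N : ℕ) (T : ℝ), ∃ C : ℝ, ∀ t : ℝ, |t| ≤ T → ∀ x : ℝ, |x| ^ N * ‖V (t, x)‖ ≤ C) :
    Nice (fun t x => (V (t, x)).re) ∧ Nice (fun t x => (V (t, x)).im) := by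
  have key : ∀ T : ℝ, ∃ C : ℝ, 0 ≤ C ∧ ∀ t, |t| ≤ T → ∀ x, ‖V (t, x)‖ ≤ C * (1 + x ^ 2)⁻¹ := by
    intro T
    obtain ⟨C, hC⟩ := hd 0 T
    obtain ⟨D, hD⟩ := hd 2 T
    refine ⟨|C| + |D|, by positivity, fun t ht x => ?_⟩
    rw [← div_eq_mul_inv, le_div_iff₀ (by positivity)]
    have h1 := hC t ht x
    have h2 := hD t ht x
    rw [sq_abs] at h2
    have := le_abs_self C
    have := le_abs_self D
    simp only [pow_zero, one_mul] at h1
    nlinarith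
  constructor
  · refine ⟨fun T => ?_, Complex.continuous_re.comp hV.continuous⟩
    obtain ⟨C, hC, K⟩ := key T
    exact ⟨C, hC, fun t ht x => (Complex.abs_re_le_norm _).trans (K t ht x)⟩
  · refine ⟨fun T => ?_, Complex.continuous_im.comp hV.continuous⟩
    obtain ⟨C, hC, K⟩ := key T
    exact ⟨C, hC, fun t ht x => (Complex.abs_im_le_norm _).trans (K t ht x)⟩

theorem norm_sq_re_im (z : ℂ) : ‖z‖ ^ 2 = z.re ^ 2 + z.im ^ 2 := by
  rw [Complex.sq_norm, Complex.normSq_apply]; ring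

theorem norm_rpow_re_im (z : ℂ) (r : ℝ) : ‖z‖ ^ r = (z.re ^ 2 + z.im ^ 2) ^ (r / 2) := by
  rw [← norm_sq_re_im, ← Real.rpow_natCast, ← Real.rpow_mul (norm_nonneg z)]
  congr 1; push_cast; ring

/-- The nonlinearity, as a smooth function. -/
def nlF (U : ℝ × ℝ → ℂ) (q : ℝ × ℝ) : ℂ :=
  Complex.I * dird (1, 0) U q + dird (0, 1) (dird (0, 1) U) q

theorem nlF_smooth {U : ℝ × ℝ → ℂ} (hU : ContDiff ℝ (⊤ : ℕ∞) U) : ContDiff ℝ (⊤ : ℕ∞) (nlF U) :=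
  (contDiff_const.mul (dird_smooth _ hU)).add (dird_smooth _ (dird_smooth _ hU))

theorem good_of_solution {p lam : ℝ} (hp : 1 < p) {u : ℝ → ℝ → ℂ} (hu : NLSSolution1 p lam u)
    {U : ℝ × ℝ → ℂ} (hUu : U = fun q => u q.1 q.2) :
    Good p lam (fun t x => (U (t, x)).re) (fun t x => (U (t, x)).im)
      (fun t x => (dird (0, 1) U (t, x)).re) (fun t x => (dird (0, 1) U (t, x)).im)
      (fun t x => (dird (0, 1) (dird (0, 1) U) (t, x)).re)
      (fun t x => (dird (0, 1) (dird (0, 1) U) (t, x)).im)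
      (fun t x => (dird (0, 1) (dird (0, 1) (dird (0, 1) U)) (t, x)).re)
      (fun t x => (dird (0, 1) (dird (0, 1) (dird (0, 1) U)) (t, x)).im)
      (fun t x => (nlF U (t, x)).re) (fun t x => (nlF U (t, x)).im)
      (fun t x => (dird (0, 1) (nlF U) (t, x)).re) (fun t x => (dird (0, 1) (nlF U) (t, x)).im) := by
  have s0 : ContDiff ℝ (⊤ : ℕ∞) U := by rw [hUu]; exact hu.smooth
  have s1 := dird_smooth (0, 1) s0
  have s2 := dird_smooth (0, 1) s1
  have s3 := dird_smooth (0, 1) s2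
  have sF := nlF_smooth s0
  have sF1 := dird_smooth (0, 1) sF
  have st := dird_smooth (1, 0) s0
  have i0 : ∀ t, iteratedDeriv 0 (u t) = fun x => U (t, x) := by
    intro t; rw [iteratedDeriv_zero, hUu]
  have i1 : ∀ t, iteratedDeriv 1 (u t) = fun x => dird (0, 1) U (t, x) := by
    intro t; rw [iteratedDeriv_succ, i0]; ext x; exact (dird_x s0 t x).deriv
  have i2 : ∀ t, iteratedDeriv 2 (u t) = fun x => dird (0, 1) (dird (0, 1) U) (t, x) := by
    intro t; rw [iteratedDeriv_succ, i1]; ext x; exact (dird_x s1 t x).deriv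
  have i3 : ∀ t, iteratedDeriv 3 (u t) =
      fun x => dird (0, 1) (dird (0, 1) (dird (0, 1) U)) (t, x) := by
    intro t; rw [iteratedDeriv_succ, i2]; ext x; exact (dird_x s2 t x).deriv
  have n0 := nice_of s0 (fun N T => by simpa only [i0] using hu.decay 0 N T)
  have n1 := nice_of s1 (fun N T => by simpa only [i1] using hu.decay 1 N T)
  have n2 := nice_of s2 (fun N T => by simpa only [i2] using hu.decay 2 N T)
  have n3 := nice_of s3 (fun N T => by simpa only [i3] using hu.decay 3 N T)
  have hE : ∀ t x, nlF U (t, x) = ((lam * ‖U (t, x)‖ ^ (p - 1) : ℝ) : ℂ) * U (t, x) := by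
    intro t x
    have h1 := hu.eq t x
    have e1 : deriv (fun s => u s x) t = dird (1, 0) U (t, x) := by
      have := (dird_t s0 t x).deriv
      rw [hUu] at this ⊢
      exact this
    have e2 : deriv (deriv (u t)) x = dird (0, 1) (dird (0, 1) U) (t, x) := by
      have := congrFun (i2 t) x
      rw [← this, iteratedDeriv_succ, iteratedDeriv_one]
    rw [e1, e2] at h1
    rw [nlF, h1, hUu]
    push_cast
    ring
  have ht : ∀ q, dird (1, 0) U q = Complex.I * (dird (0, 1) (dird (0, 1) U) q - nlF U q) := by
    intro q
    rw [nlF]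
    linear_combination (dird (1, 0) U q) * Complex.I_sq
  have htx : ∀ t x, dird (1, 0) (dird (0, 1) U) (t, x) =
      Complex.I * (dird (0, 1) (dird (0, 1) (dird (0, 1) U)) (t, x) - dird (0, 1) (nlF U) (t, x)) := by
    intro t x
    rw [dird_comm s0]
    have h1 := dird_x st t x
    have h2 := ((dird_x s2 t x).fun_sub (dird_x sF t x)).const_mul Complex.I
    simp only [ht] at h1
    exact h1.unique h2
  refine ⟨hp, n0.1, n0.2, n1.1, n1.2, n2.1, n2.2, n3.1, n3.2,
    Complex.continuous_re.comp sF.continuous, Complex.continuous_im.comp sF.continuous,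
    Complex.continuous_re.comp sF1.continuous, Complex.continuous_im.comp sF1.continuous,
    fun t x => hasDerivAt_re (dird_x s0 t x), fun t x => hasDerivAt_im (dird_x s0 t x),
    fun t x => hasDerivAt_re (dird_x s1 t x), fun t x => hasDerivAt_im (dird_x s1 t x),
    fun t x => hasDerivAt_re (dird_x s2 t x), fun t x => hasDerivAt_im (dird_x s2 t x),
    fun t x => hasDerivAt_re (dird_x sF t x), fun t x => hasDerivAt_im (dird_x sF t x),
    fun t x => (hasDerivAt_re (dird_t s0 t x)).congr_deriv ?_,
    fun t x => (hasDerivAt_im (dird_t s0 t x)).congr_deriv ?_,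
    fun t x => (hasDerivAt_re (dird_t s1 t x)).congr_deriv ?_,
    fun t x => (hasDerivAt_im (dird_t s1 t x)).congr_deriv ?_, fun t x => ?_, fun t x => ?_⟩
  · rw [ht]; simp; ring
  · rw [ht]; simp
  · rw [htx]; simp; ring
  · rw [htx]; simp
  · simp only [hE]; rw [Complex.re_ofReal_mul, norm_rpow_re_im]
  · simp only [hE]; rw [Complex.im_ofReal_mul, norm_rpow_re_im]

/-- Interaction Morawetz inequality, `n = 1`. -/
theorem statement_1 (p lam : ℝ) (hp : 1 < p)
    (u : ℝ → ℝ → ℂ) (hu : NLSSolution1 p lam u) :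
    (∫ t : ℝ, ∫ x : ℝ, (deriv (fun z => ‖u t z‖ ^ 2) x) ^ 2)
      + lam * ((p - 1) / (p + 1)) * (∫ t : ℝ, ∫ x : ℝ, ‖u t x‖ ^ (p + 3))
    ≤ (Real.sqrt (∫ x : ℝ, ‖u 0 x‖ ^ 2)) ^ 3
        * (⨆ t : ℝ, Real.sqrt (∫ x : ℝ, ‖deriv (u t) x‖ ^ 2)) := by
  have h := good_of_solution hp hu rfl
  have hx : ∀ t x, deriv (u t) x = dird (0, 1) (fun q : ℝ × ℝ => u q.1 q.2) (t, x) :=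
    fun t x => (dird_x hu.smooth t x).deriv
  have hr : ∀ t x, deriv (fun z => (u t z).re ^ 2 + (u t z).im ^ 2) x =
      2 * ((u t x).re * (dird (0, 1) (fun q : ℝ × ℝ => u q.1 q.2) (t, x)).re +
        (u t x).im * (dird (0, 1) (fun q : ℝ × ℝ => u q.1 q.2) (t, x)).im) :=
    fun t x => (h.dxrho t x).deriv
  simp only [norm_rpow_re_im, norm_sq_re_im, hx, hr]
  exact h.main
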